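/- Let E be a local pointed metric space, let {f_n} be a sequence in Lip_0(E) with ‖f_n‖ = 1 for all n, and let U_n := {x ∈ E : f_n(x) ≠ 0} be the corresponding supports. Suppose the sets U_n are pairwise separated, i.e. inf{ρ(x,y) : x ∈ U_n, y ∈ U_m} > 0 for every n ≠ m. Then for every n ∈ ℕ and every finite collection a_1,…,a_n of reals, ‖Σ_{j=1}^n a_j f_j‖ = max_k |a_k|. -/

import Mathlib

open Filter Topology

/-- `L` is the smallest Lipschitz constant of `f` (the Lipschitz norm of `f`). -/
def IsLipNorm {E : Type*} [PseudoMetricSpace E] (f : E → ℝ) (L : ℝ) : Prop :=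
  IsLeast {K : ℝ | 0 ≤ K ∧ ∀ x y : E, |f x - f y| ≤ K * dist x y} L

/-- A pointed metric space `(E, e₀)` is local: for every `ε > 0` and every
`f ∈ Lip₀(E)` there are distinct points `t₁, t₂` with `dist t₁ t₂ < ε` and
`(f t₂ - f t₁)/dist t₁ t₂ > ‖f‖ - ε`. -/
def IsLocal {E : Type*} [MetricSpace E] (e₀ : E) : Prop :=
  ∀ ε > (0:ℝ), ∀ f : E → ℝ, f e₀ = 0 → ∀ L : ℝ, IsLipNorm f L →
    ∃ t₁ t₂ : E, t₁ ≠ t₂ ∧ dist t₁ t₂ < ε ∧ (f t₂ - f t₁) / dist t₁ t₂ > L - ε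

/-- A function with some Lipschitz constant has a smallest one. -/
theorem exists_isLipNorm {E : Type*} [PseudoMetricSpace E] {f : E → ℝ} {C : ℝ} (hC : 0 ≤ C)
    (hf : ∀ x y, |f x - f y| ≤ C * dist x y) : ∃ L, IsLipNorm f L := by
  have hclosed : IsClosed {K : ℝ | 0 ≤ K ∧ ∀ x y : E, |f x - f y| ≤ K * dist x y} := by
    simp only [Set.ofPred_and, Set.ofPred_forall]
    exact (isClosed_le continuous_const continuous_id).inter
      (isClosed_iInter fun x => isClosed_iInter fun y =>
        isClosed_le continuous_const (continuous_id.mul continuous_const))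
  exact ⟨_, hclosed.isLeast_csInf ⟨C, hC, hf⟩ ⟨0, fun _ h => h.1⟩⟩

/-- For finitely many functions with pairwise separated supports, at most one of them is
nonzero on any pair of sufficiently close points. -/
theorem exists_forall_dist_lt_eq_zero {E ι : Type*} [PseudoMetricSpace E] [Finite ι] {f : ι → E → ℝ}
    (hsep : ∀ i j, i ≠ j → ∃ d > (0:ℝ), ∀ x y : E, f i x ≠ 0 → f j y ≠ 0 → d ≤ dist x y) :
    ∃ δ > (0:ℝ), ∀ x y : E, dist x y < δ → ∀ i j, i ≠ j →
      (f i x ≠ 0 ∨ f i y ≠ 0) → f j x = 0 ∧ f j y = 0 := by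
  have h : ∀ᶠ δ in 𝓝[>] (0:ℝ), ∀ i j, i ≠ j → ∀ x y : E, f i x ≠ 0 → f j y ≠ 0 → δ ≤ dist x y := by
    refine eventually_all.2 fun i => eventually_all.2 fun j => ?_
    by_cases hij : i = j
    · simp [hij]
    · obtain ⟨d, hd, h⟩ := hsep i j hij
      filter_upwards [Ioo_mem_nhdsGT hd] with δ hδ _ x y hx hy
      exact hδ.2.le.trans (h x y hx hy)
  obtain ⟨δ, h, hδ⟩ := (h.and self_mem_nhdsWithin).exists
  have hδ : 0 < δ := hδ
  refine ⟨δ, hδ, fun x y hxy i j hij hi => ?_⟩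
  have hyx : dist y x < δ := by rwa [dist_comm]
  have hne : ∀ p q : E, dist p q < δ → f i p ≠ 0 → f j q = 0 := fun p q hpq hp => by
    by_contra hq
    exact absurd (h i j hij p q hp hq) hpq.not_ge
  rcases hi with hi | hi
  · exact ⟨hne x x (by simpa using hδ) hi, hne x y hxy hi⟩
  · exact ⟨hne y x hyx hi, hne y y (by simpa using hδ) hi⟩

theorem stmt4 {E : Type*} [MetricSpace E] (e₀ : E) (hloc : IsLocal e₀)
    (f : ℕ → E → ℝ) (hf0 : ∀ n, f n e₀ = 0) (hf1 : ∀ n, IsLipNorm (f n) 1)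
    (hsep : ∀ n m : ℕ, n ≠ m →
      ∃ d > (0:ℝ), ∀ x y : E, f n x ≠ 0 → f m y ≠ 0 → d ≤ dist x y) :
    ∀ (n : ℕ) (a : Fin (n + 1) → ℝ),
      IsLipNorm (fun x => ∑ j : Fin (n + 1), a j * f (j : ℕ) x) (⨆ k, |a k|) := by
  intro n a
  set g : E → ℝ := fun x => ∑ j : Fin (n + 1), a j * f (j : ℕ) x with hg
  have hle : ∀ k, |a k| ≤ ⨆ k, |a k| := le_ciSup (Set.finite_range fun k => |a k|).bddAbove
  have hM : 0 ≤ ⨆ k, |a k| := (abs_nonneg _).trans (hle 0)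
  have hlip : ∀ j x y, |f j x - f j y| ≤ dist x y := fun j x y => by
    simpa using (hf1 j).1.2 x y
  have hsub : ∀ x y, g x - g y = ∑ j : Fin (n + 1), a j * (f j x - f j y) := fun x y => by
    simp only [hg, mul_sub, Finset.sum_sub_distrib]
  obtain ⟨δ, hδ, hsupp⟩ := exists_forall_dist_lt_eq_zero (f := fun j : Fin (n + 1) => f j)
    fun i j hij => hsep i j fun h => hij (Fin.ext h)
  have hsingle : ∀ x y, dist x y < δ → ∀ k : Fin (n + 1), (f k x ≠ 0 ∨ f k y ≠ 0) →
      g x - g y = a k * (f k x - f k y) := fun x y hxy k hk => by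
    rw [hsub]
    refine Finset.sum_eq_single k (fun j _ hj => ?_) (by simp)
    obtain ⟨h₁, h₂⟩ := hsupp x y hxy k j hj.symm hk
    simp [h₁, h₂]
  obtain ⟨L, hL⟩ : ∃ L, IsLipNorm g L := by
    refine exists_isLipNorm (C := ∑ j, |a j|) (by positivity) fun x y => ?_
    rw [hsub, Finset.sum_mul]
    refine (Finset.abs_sum_le_sum_abs _ _).trans (Finset.sum_le_sum fun j _ => ?_)
    rw [abs_mul]
    exact mul_le_mul_of_nonneg_left (hlip j x y) (abs_nonneg _)
  have hLM : L ≤ ⨆ k, |a k| := by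
    refine le_of_forall_pos_le_add fun ε hε => ?_
    obtain ⟨s, t, hst, hd, h⟩ := hloc (min ε δ) (lt_min hε hδ) g (by simp [hg, hf0]) L hL
    have hpos : 0 < dist s t := dist_pos.2 hst
    have hgM : g t - g s ≤ (⨆ k, |a k|) * dist s t := by
      by_cases hk : ∃ k : Fin (n + 1), f k t ≠ 0 ∨ f k s ≠ 0
      · obtain ⟨k, hk⟩ := hk
        rw [dist_comm] at hd ⊢
        rw [hsingle t s (hd.trans_le (min_le_right _ _)) k hk]
        refine (le_abs_self _).trans ?_
        rw [abs_mul]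
        exact mul_le_mul (hle k) (hlip k t s) (abs_nonneg _) hM
      · push Not at hk
        rw [hsub]
        simp only [hk, sub_self, mul_zero, Finset.sum_const_zero]
        positivity
    have := (div_le_iff₀ hpos).2 hgM
    linarith [min_le_left ε δ]
  refine ⟨⟨hM, fun x y => (hL.1.2 x y).trans (mul_le_mul_of_nonneg_right hLM dist_nonneg)⟩, ?_⟩
  rintro K ⟨hK, hgK⟩
  refine ciSup_le fun k => ?_
  have hbound : ∀ᶠ ε in 𝓝[>] (0:ℝ), |a k| * (1 - ε) ≤ K := by
    filter_upwards [Ioo_mem_nhdsGT (lt_min one_pos hδ)] with ε hε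
    obtain ⟨s, t, hst, hd, h⟩ := hloc ε hε.1 (f k) (hf0 k) 1 (hf1 k)
    have hpos : 0 < dist s t := dist_pos.2 hst
    have hε₁ : ε < 1 := hε.2.trans_le (min_le_left _ _)
    have hdiff := (lt_div_iff₀ hpos).1 h
    have hdiff_pos : 0 < f k t - f k s := (mul_pos (by linarith) hpos).trans hdiff
    have hk : f k t ≠ 0 ∨ f k s ≠ 0 := by
      by_contra! hk
      simp [hk] at hdiff_pos
    have hgts := hgK t s
    rw [dist_comm] at hd
    rw [hsingle t s (hd.trans (hε.2.trans_le (min_le_right _ _))) k hk, abs_mul,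
      abs_of_pos hdiff_pos, dist_comm] at hgts
    refine le_of_mul_le_mul_right ?_ hpos
    rw [mul_assoc]
    exact (mul_le_mul_of_nonneg_left hdiff.le (abs_nonneg _)).trans hgts
  have hlim : Tendsto (fun ε : ℝ => |a k| * (1 - ε)) (𝓝[>] 0) (𝓝 (|a k| * (1 - 0))) :=
    ((by fun_prop : Continuous fun ε : ℝ => |a k| * (1 - ε)).tendsto 0).mono_left
      nhdsWithin_le_nhds
  simpa using le_of_tendsto hlim hbound
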